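/- arXiv:2205.04384 — 2 statements merged into one kernel-verified Lean document; each statement's English description precedes it below -/
import Mathlib

section
/- Values PC: Let v be a FLAQR value with Π;Γ;pc;c ⊢ v : τ. If Π ⊩ c' ≽ pc' and Π ⊩ c' ≽ C(τ), then Π;Γ;pc';c' ⊢ v : τ. -/
set_option maxHeartbeats 1000000

namespace FLAQR

/-! ## Principals and the acts-for relation -/

inductive Proj where
  | c | i | a
  deriving DecidableEq, Repr

inductive Prin where
  | name : String → Prin
  | top : Prin
  | bot : Prin
  | proj : Prin → Proj → Prin
  | conj : Prin → Prin → Prin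
  | disj : Prin → Prin → Prin
  | pand : Prin → Prin → Prin     -- partial conjunction  ∧̃
  | por  : Prin → Prin → Prin     -- partial disjunction  ⊕̃
  deriving DecidableEq, Repr

/-- Delegation context. -/
abbrev DCtx := Set (Prin × Prin)

/-- The FLAQR acts-for relation `Π ⊩ p ≽ q`: FLAM static lattice rules
    together with the rules for partial conjunction/disjunction. -/
inductive ActsFor (Pi : DCtx) : Prin → Prin → Prop where
  | assump {p q : Prin} : (p, q) ∈ Pi → ActsFor Pi p q
  | bot (p) : ActsFor Pi p .bot
  | top (p) : ActsFor Pi .top p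
  | refl (p) : ActsFor Pi p p
  | trans {p q r : Prin} : ActsFor Pi p q → ActsFor Pi q r → ActsFor Pi p r
  | projMono {p q : Prin} (π : Proj) : ActsFor Pi p q → ActsFor Pi (p.proj π) (q.proj π)
  | projR {p : Prin} {π : Proj} : ActsFor Pi p (p.proj π)
  | projIdemp {p : Prin} {π : Proj} : ActsFor Pi ((p.proj π).proj π) (p.proj π)
  | projBasis {p : Prin} {π π' : Proj} : π ≠ π' → ActsFor Pi .bot ((p.proj π).proj π')
  | projDistConj {p q : Prin} {π : Proj} : ActsFor Pi (.conj (p.proj π) (q.proj π)) ((Prin.conj p q).proj π)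
  | projDistDisj {p q : Prin} {π : Proj} : ActsFor Pi ((Prin.disj p q).proj π) (.disj (p.proj π) (q.proj π))
  | conjL1 {p1 p2 p : Prin} : ActsFor Pi p1 p → ActsFor Pi (.conj p1 p2) p
  | conjL2 {p1 p2 p : Prin} : ActsFor Pi p2 p → ActsFor Pi (.conj p1 p2) p
  | conjR {p p1 p2 : Prin} : ActsFor Pi p p1 → ActsFor Pi p p2 → ActsFor Pi p (.conj p1 p2)
  | conjBasis {p : Prin} : ActsFor Pi (.conj (.conj (p.proj .c) (p.proj .i)) (p.proj .a)) p
  | disjL {p1 p2 p : Prin} : ActsFor Pi p1 p → ActsFor Pi p2 p → ActsFor Pi (.disj p1 p2) p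
  | disjR1 {p p1 p2 : Prin} : ActsFor Pi p p1 → ActsFor Pi p (.disj p1 p2)
  | disjR2 {p p1 p2 : Prin} : ActsFor Pi p p2 → ActsFor Pi p (.disj p1 p2)
  | disjBasis {p q : Prin} {π π' : Proj} : π ≠ π' → ActsFor Pi .bot (.disj (p.proj π) (q.proj π'))
  | conjDistDisjL {p q r : Prin} : ActsFor Pi (.disj (.conj p q) (.conj p r)) (.conj p (.disj q r))
  | conjDistDisjR {p q r : Prin} : ActsFor Pi (.conj p (.disj q r)) (.disj (.conj p q) (.conj p r))
  | disjDistConjL {p q r : Prin} : ActsFor Pi (.conj (.disj p q) (.disj p r)) (.disj p (.conj q r))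
  | disjDistConjR {p q r : Prin} : ActsFor Pi (.disj p (.conj q r)) (.conj (.disj p q) (.disj p r))
  -- partial conjunction / disjunction rules
  | pandL1 {p1 p2 p : Prin} : ActsFor Pi p1 p → ActsFor Pi (.pand p1 p2) p
  | pandL2 {p1 p2 p : Prin} : ActsFor Pi p2 p → ActsFor Pi (.pand p1 p2) p
  | pandR {p p1 p2 : Prin} : ActsFor Pi p p1 → ActsFor Pi p p2 → ActsFor Pi p (.pand p1 p2)
  | andPAnd {p q : Prin} : ActsFor Pi (.conj p q) (.pand p q)
  | pandPOr {p q : Prin} : ActsFor Pi (.pand p q) (.por p q)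
  | projPAndL {p q : Prin} {π : Proj} : ActsFor Pi (.pand (p.proj π) (q.proj π)) ((Prin.pand p q).proj π)
  | projPAndR {p q : Prin} {π : Proj} : ActsFor Pi ((Prin.pand p q).proj π) (.pand (p.proj π) (q.proj π))
  | projPOrL {p q : Prin} {π : Proj} : ActsFor Pi (.por (p.proj π) (q.proj π)) ((Prin.por p q).proj π)
  | projPOrR {p q : Prin} {π : Proj} : ActsFor Pi ((Prin.por p q).proj π) (.por (p.proj π) (q.proj π))
  | porOr {p q : Prin} : ActsFor Pi (.por p q) (.disj p q)
  | andDistPOrR {p q r : Prin} : ActsFor Pi (.conj p (.por q r)) (.por (.conj p q) (.conj p r))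
  | porDistAndR {p q r : Prin} : ActsFor Pi (.por p (.conj q r)) (.conj (.por p q) (.por p r))
  | andDistPOrL {p q r : Prin} : ActsFor Pi (.por (.conj p q) (.conj p r)) (.conj p (.por q r))
  | porDistAndL {p q r : Prin} : ActsFor Pi (.conj (.por p q) (.por p r)) (.por p (.conj q r))
  | orDistPOrR {p q r : Prin} : ActsFor Pi (.disj p (.por q r)) (.por (.disj p q) (.disj p r))
  | orDistPOrL {p q r : Prin} : ActsFor Pi (.por (.disj p q) (.disj p r)) (.disj p (.por q r))
  | porDistOrR {p q r : Prin} : ActsFor Pi (.por p (.disj q r)) (.disj (.por p q) (.por p r))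
  | porDistOrL {p q r : Prin} : ActsFor Pi (.disj (.por p q) (.por p r)) (.por p (.disj q r))
  | andDistPAndR {p q r : Prin} : ActsFor Pi (.conj p (.pand q r)) (.pand (.conj p q) (.conj p r))
  | pandDistAndR {p q r : Prin} : ActsFor Pi (.pand p (.conj q r)) (.conj (.pand p q) (.pand p r))
  | andDistPAndL {p q r : Prin} : ActsFor Pi (.pand (.conj p q) (.conj p r)) (.conj p (.pand q r))
  | pandDistAndL {p q r : Prin} : ActsFor Pi (.conj (.pand p q) (.pand p r)) (.pand p (.conj q r))
  | orDistPAndR {p q r : Prin} : ActsFor Pi (.disj p (.pand q r)) (.pand (.disj p q) (.disj p r))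
  | orDistPAndL {p q r : Prin} : ActsFor Pi (.pand (.disj p q) (.disj p r)) (.disj p (.pand q r))
  | pandDistOrR {p q r : Prin} : ActsFor Pi (.pand p (.disj q r)) (.disj (.pand p q) (.pand p r))
  | pandDistOrL {p q r : Prin} : ActsFor Pi (.disj (.pand p q) (.pand p r)) (.pand p (.disj q r))

/-- The flows-to relation `Π ⊢ p ⊑ q`. -/
def FlowsTo (Pi : DCtx) (p q : Prin) : Prop :=
  ActsFor Pi (q.proj .c) (p.proj .c) ∧ ActsFor Pi (p.proj .i) (q.proj .i) ∧
    ActsFor Pi (p.proj .a) (q.proj .a)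

/-- The information-flow join `p ⊔ q`. -/
def pJoin (p q : Prin) : Prin :=
  .conj (.conj (.conj (p.proj .c) (q.proj .c)) (.disj (p.proj .i) (q.proj .i)))
        (.disj (p.proj .a) (q.proj .a))

/-- The compare action on principals `ℓ1 ⊗ ℓ2`. -/
def cmpAct (l1 l2 : Prin) : Prin :=
  .conj (.conj (.conj (l1.proj .c) (l2.proj .c)) (.pand (l1.proj .i) (l2.proj .i)))
        (.disj (l1.proj .a) (l2.proj .a))

/-- The select action on principals `ℓ1 ⊕ ℓ2`. -/
def selAct (l1 l2 : Prin) : Prin :=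
  .conj (.conj (.conj (l1.proj .c) (l2.proj .c)) (.por (l1.proj .i) (l2.proj .i)))
        (.conj (l1.proj .a) (l2.proj .a))

/-- `p^{i∧a}`. -/
def reach (p : Prin) : Prin := .conj (p.proj .i) (p.proj .a)

/-! ## Types -/

inductive Ty where
  | unit : Ty
  | tvar : String → Ty
  | sum : Ty → Ty → Ty
  | prod : Ty → Ty → Ty
  | fn : Ty → Prin → Ty → Ty
  | poly : String → Prin → Ty → Ty
  | says : Prin → Ty → Ty
  deriving DecidableEq, Repr

/-- Clearance `C(τ)`. -/
def clearance : Ty → Prin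
  | .unit => .bot
  | .tvar _ => .bot
  | .sum t1 t2 => pJoin (clearance t1) (clearance t2)
  | .prod t1 t2 => pJoin (clearance t1) (clearance t2)
  | .fn t1 pc t2 => pJoin (clearance t1) (pJoin pc (clearance t2))
  | .poly _ pc t => pJoin pc (clearance t)
  | .says _ t => clearance t

/-- Availability of a type `τ^a`. -/
def tyAvail : Ty → Prin
  | .unit => .top
  | .tvar _ => .top
  | .sum t1 t2 => pJoin (tyAvail t1) (tyAvail t2)
  | .prod t1 t2 => pJoin (tyAvail t1) (tyAvail t2)
  | .fn t1 pc t2 => pJoin (tyAvail t1) (pJoin (pc.proj .a) (tyAvail t2))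
  | .poly _ pc t => pJoin (pc.proj .a) (tyAvail t)
  | .says l t => pJoin (l.proj .a) (tyAvail t)

/-- The `𝒞` function on types, turning partial operations into full ones. -/
def cfunTy : Ty → Ty
  | .unit => .unit
  | .tvar X => .tvar X
  | .sum t1 t2 => .sum (cfunTy t1) (cfunTy t2)
  | .prod t1 t2 => .prod (cfunTy t1) (cfunTy t2)
  | .fn t1 pc t2 => .fn (cfunTy t1) pc (cfunTy t2)
  | .poly X pc t => .poly X pc (cfunTy t)
  | .says (.por l1 l2) t => .says (.disj l1 l2) (cfunTy t)
  | .says (.pand l1 l2) t => .says (.conj l1 l2) (cfunTy t)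
  | .says l t => .says l (cfunTy t)

/-- Substitution of a type for a type variable in a type. -/
def Ty.substT : Ty → String → Ty → Ty
  | .unit, _, _ => .unit
  | .tvar Y, X, s => if Y = X then s else .tvar Y
  | .sum t1 t2, X, s => .sum (t1.substT X s) (t2.substT X s)
  | .prod t1 t2, X, s => .prod (t1.substT X s) (t2.substT X s)
  | .fn t1 pc t2, X, s => .fn (t1.substT X s) pc (t2.substT X s)
  | .poly Y pc t, X, s => if Y = X then .poly Y pc t else .poly Y pc (t.substT X s)
  | .says l t, X, s => .says l (t.substT X s)

/-- Free type variables of a type. -/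
def Ty.ftv : Ty → List String
  | .unit => []
  | .tvar X => [X]
  | .sum t1 t2 => t1.ftv ++ t2.ftv
  | .prod t1 t2 => t1.ftv ++ t2.ftv
  | .fn t1 _ t2 => t1.ftv ++ t2.ftv
  | .poly X _ t => t.ftv.filter (· ≠ X)
  | .says _ t => t.ftv

/-! ## Expressions -/

inductive Expr where
  | var : String → Expr
  | unit : Expr
  | lam : String → Ty → Prin → Expr → Expr
  | tlam : String → Prin → Expr → Expr
  | app : Expr → Expr → Expr
  | tapp : Expr → Ty → Expr
  | pair : Expr → Expr → Ty → Expr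
  | proj1 : Expr → Expr
  | proj2 : Expr → Expr
  | injl : Ty → Expr → Expr
  | injr : Ty → Expr → Expr
  | caseE : Expr → String → Expr → Expr → Ty → Expr
  | ret : Prin → Expr → Expr            -- η_ℓ e
  | sealed : Prin → Expr → Expr         -- η̄_ℓ v
  | bind : String → Expr → Expr → Expr
  | run : Ty → Expr → Prin → Expr
  | retTo : Expr → Prin → Expr
  | expect : Ty → Expr
  | compare : Ty → Expr → Expr → Expr
  | select : Expr → Expr → Ty → Expr
  | fail : Ty → Expr
  | bracket : Expr → Expr → Expr
  | hole : Expr                         -- •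
  | circ : Expr
  deriving DecidableEq, Repr

inductive IsValue : Expr → Prop where
  | unit : IsValue .unit
  | lam {x τ pc e} : IsValue (.lam x τ pc e)
  | tlam {X pc e} : IsValue (.tlam X pc e)
  | sealed {l v} : IsValue v → IsValue (.sealed l v)
  | pair {v1 v2 τ} : IsValue v1 → IsValue v2 → IsValue (.pair v1 v2 τ)
  | injl {τ v} : IsValue v → IsValue (.injl τ v)
  | injr {τ v} : IsValue v → IsValue (.injr τ v)
  | bracket {v1 v2} : IsValue v1 → IsValue v2 → IsValue (.bracket v1 v2)

/-- `f` terms: values or fail terms. -/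
def IsResult (e : Expr) : Prop := IsValue e ∨ ∃ τ, e = .fail τ

/-- Projection `⌊e⌋_k` of a bracketed expression (`true` = 1, `false` = 2). -/
def bproj (k : Bool) : Expr → Expr
  | .var x => .var x
  | .unit => .unit
  | .lam x τ pc e => .lam x τ pc (bproj k e)
  | .tlam X pc e => .tlam X pc (bproj k e)
  | .app e1 e2 => .app (bproj k e1) (bproj k e2)
  | .tapp e τ => .tapp (bproj k e) τ
  | .pair e1 e2 τ => .pair (bproj k e1) (bproj k e2) τ
  | .proj1 e => .proj1 (bproj k e)
  | .proj2 e => .proj2 (bproj k e)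
  | .injl τ e => .injl τ (bproj k e)
  | .injr τ e => .injr τ (bproj k e)
  | .caseE e x e1 e2 τ => .caseE (bproj k e) x (bproj k e1) (bproj k e2) τ
  | .ret l e => .ret l (bproj k e)
  | .sealed l e => .sealed l (bproj k e)
  | .bind x e1 e2 => .bind x (bproj k e1) (bproj k e2)
  | .run τ e p => .run τ (bproj k e) p
  | .retTo e p => .retTo (bproj k e) p
  | .expect τ => .expect τ
  | .compare τ e1 e2 => .compare τ (bproj k e1) (bproj k e2)
  | .select e1 e2 τ => .select (bproj k e1) (bproj k e2) τ
  | .fail τ => .fail τ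
  | .bracket e1 e2 => if k then bproj k e1 else bproj k e2
  | .hole => .hole
  | .circ => .circ

/-- Capture-avoiding substitution `e[x ↦ v]`; inside a bracket the
    corresponding projection of `v` is substituted. -/
def subst : Expr → String → Expr → Expr
  | .var y, x, v => if y = x then v else .var y
  | .unit, _, _ => .unit
  | .lam y τ pc e, x, v => if y = x then .lam y τ pc e else .lam y τ pc (subst e x v)
  | .tlam Y pc e, x, v => .tlam Y pc (subst e x v)
  | .app e1 e2, x, v => .app (subst e1 x v) (subst e2 x v)
  | .tapp e τ, x, v => .tapp (subst e x v) τ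
  | .pair e1 e2 τ, x, v => .pair (subst e1 x v) (subst e2 x v) τ
  | .proj1 e, x, v => .proj1 (subst e x v)
  | .proj2 e, x, v => .proj2 (subst e x v)
  | .injl τ e, x, v => .injl τ (subst e x v)
  | .injr τ e, x, v => .injr τ (subst e x v)
  | .caseE e y e1 e2 τ, x, v =>
      .caseE (subst e x v) y (if y = x then e1 else subst e1 x v)
        (if y = x then e2 else subst e2 x v) τ
  | .ret l e, x, v => .ret l (subst e x v)
  | .sealed l e, x, v => .sealed l (subst e x v)
  | .bind y e1 e2, x, v => .bind y (subst e1 x v) (if y = x then e2 else subst e2 x v)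
  | .run τ e p, x, v => .run τ (subst e x v) p
  | .retTo e p, x, v => .retTo (subst e x v) p
  | .expect τ, _, _ => .expect τ
  | .compare τ e1 e2, x, v => .compare τ (subst e1 x v) (subst e2 x v)
  | .select e1 e2 τ, x, v => .select (subst e1 x v) (subst e2 x v) τ
  | .fail τ, _, _ => .fail τ
  | .bracket e1 e2, x, v => .bracket (subst e1 x (bproj true v)) (subst e2 x (bproj false v))
  | .hole, _, _ => .hole
  | .circ, _, _ => .circ

/-- Substitution of a type for a type variable in an expression. -/
def substTE : Expr → String → Ty → Expr
  | .var x, _, _ => .var x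
  | .unit, _, _ => .unit
  | .lam x τ pc e, X, s => .lam x (τ.substT X s) pc (substTE e X s)
  | .tlam Y pc e, X, s => if Y = X then .tlam Y pc e else .tlam Y pc (substTE e X s)
  | .app e1 e2, X, s => .app (substTE e1 X s) (substTE e2 X s)
  | .tapp e τ, X, s => .tapp (substTE e X s) (τ.substT X s)
  | .pair e1 e2 τ, X, s => .pair (substTE e1 X s) (substTE e2 X s) (τ.substT X s)
  | .proj1 e, X, s => .proj1 (substTE e X s)
  | .proj2 e, X, s => .proj2 (substTE e X s)
  | .injl τ e, X, s => .injl (τ.substT X s) (substTE e X s)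
  | .injr τ e, X, s => .injr (τ.substT X s) (substTE e X s)
  | .caseE e x e1 e2 τ, X, s =>
      .caseE (substTE e X s) x (substTE e1 X s) (substTE e2 X s) (τ.substT X s)
  | .ret l e, X, s => .ret l (substTE e X s)
  | .sealed l e, X, s => .sealed l (substTE e X s)
  | .bind x e1 e2, X, s => .bind x (substTE e1 X s) (substTE e2 X s)
  | .run τ e p, X, s => .run (τ.substT X s) (substTE e X s) p
  | .retTo e p, X, s => .retTo (substTE e X s) p
  | .expect τ, X, s => .expect (τ.substT X s)
  | .compare τ e1 e2, X, s => .compare (τ.substT X s) (substTE e1 X s) (substTE e2 X s)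
  | .select e1 e2 τ, X, s => .select (substTE e1 X s) (substTE e2 X s) (τ.substT X s)
  | .fail τ, X, s => .fail (τ.substT X s)
  | .bracket e1 e2, X, s => .bracket (substTE e1 X s) (substTE e2 X s)
  | .hole, _, _ => .hole
  | .circ, _, _ => .circ

/-- Source-level expressions: no `fail` subterms. -/
def NoFail : Expr → Prop
  | .var _ => True
  | .unit => True
  | .lam _ _ _ e => NoFail e
  | .tlam _ _ e => NoFail e
  | .app e1 e2 => NoFail e1 ∧ NoFail e2
  | .tapp e _ => NoFail e
  | .pair e1 e2 _ => NoFail e1 ∧ NoFail e2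
  | .proj1 e => NoFail e
  | .proj2 e => NoFail e
  | .injl _ e => NoFail e
  | .injr _ e => NoFail e
  | .caseE e _ e1 e2 _ => NoFail e ∧ NoFail e1 ∧ NoFail e2
  | .ret _ e => NoFail e
  | .sealed _ e => NoFail e
  | .bind _ e1 e2 => NoFail e1 ∧ NoFail e2
  | .run _ e _ => NoFail e
  | .retTo e _ => NoFail e
  | .expect _ => True
  | .compare _ e1 e2 => NoFail e1 ∧ NoFail e2
  | .select e1 e2 _ => NoFail e1 ∧ NoFail e2
  | .fail _ => False
  | .bracket e1 e2 => NoFail e1 ∧ NoFail e2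
  | .hole => True
  | .circ => True

/-- `e` contains a subterm `fail_τ`. -/
def ContainsFail (τ : Ty) : Expr → Prop
  | .var _ => False
  | .unit => False
  | .lam _ _ _ e => ContainsFail τ e
  | .tlam _ _ e => ContainsFail τ e
  | .app e1 e2 => ContainsFail τ e1 ∨ ContainsFail τ e2
  | .tapp e _ => ContainsFail τ e
  | .pair e1 e2 _ => ContainsFail τ e1 ∨ ContainsFail τ e2
  | .proj1 e => ContainsFail τ e
  | .proj2 e => ContainsFail τ e
  | .injl _ e => ContainsFail τ e
  | .injr _ e => ContainsFail τ e
  | .caseE e _ e1 e2 _ => ContainsFail τ e ∨ ContainsFail τ e1 ∨ ContainsFail τ e2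
  | .ret _ e => ContainsFail τ e
  | .sealed _ e => ContainsFail τ e
  | .bind _ e1 e2 => ContainsFail τ e1 ∨ ContainsFail τ e2
  | .run _ e _ => ContainsFail τ e
  | .retTo e _ => ContainsFail τ e
  | .expect _ => False
  | .compare _ e1 e2 => ContainsFail τ e1 ∨ ContainsFail τ e2
  | .select e1 e2 _ => ContainsFail τ e1 ∨ ContainsFail τ e2
  | .fail τ' => τ' = τ
  | .bracket e1 e2 => ContainsFail τ e1 ∨ ContainsFail τ e2
  | .hole => False
  | .circ => False

/-! ## Evaluation contexts -/

inductive ECtx where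
  | hole : ECtx
  | appL : ECtx → Expr → ECtx
  | appR : Expr → ECtx → ECtx
  | tappC : ECtx → Ty → ECtx
  | pairL : ECtx → Expr → Ty → ECtx
  | pairR : Expr → ECtx → Ty → ECtx
  | retC : Prin → ECtx → ECtx
  | proj1C : ECtx → ECtx
  | proj2C : ECtx → ECtx
  | injlC : Ty → ECtx → ECtx
  | injrC : Ty → ECtx → ECtx
  | bindC : String → ECtx → Expr → ECtx
  | caseC : ECtx → String → Expr → Expr → Ty → ECtx
  | retToC : ECtx → Prin → ECtx
  | selectL : ECtx → Expr → Ty → ECtx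
  | selectR : Expr → ECtx → Ty → ECtx
  | compareL : Ty → ECtx → Expr → ECtx
  | compareR : Ty → Expr → ECtx → ECtx

def ECtx.fill : ECtx → Expr → Expr
  | .hole, e => e
  | .appL K e2, e => .app (K.fill e) e2
  | .appR v K, e => .app v (K.fill e)
  | .tappC K τ, e => .tapp (K.fill e) τ
  | .pairL K e2 τ, e => .pair (K.fill e) e2 τ
  | .pairR f K τ, e => .pair f (K.fill e) τ
  | .retC l K, e => .ret l (K.fill e)
  | .proj1C K, e => .proj1 (K.fill e)
  | .proj2C K, e => .proj2 (K.fill e)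
  | .injlC τ K, e => .injl τ (K.fill e)
  | .injrC τ K, e => .injr τ (K.fill e)
  | .bindC x K e2, e => .bind x (K.fill e) e2
  | .caseC K x e1 e2 τ, e => .caseE (K.fill e) x e1 e2 τ
  | .retToC K c, e => .retTo (K.fill e) c
  | .selectL K e2 τ, e => .select (K.fill e) e2 τ
  | .selectR f K τ, e => .select f (K.fill e) τ
  | .compareL τ K e2, e => .compare τ (K.fill e) e2
  | .compareR τ f K, e => .compare τ f (K.fill e)

/-- Well-formedness of evaluation contexts (positions to the left of the
    hole must already be values / results, as in the context grammar). -/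
def ECtx.Wf : ECtx → Prop
  | .hole => True
  | .appL K _ => K.Wf
  | .appR v K => IsValue v ∧ K.Wf
  | .tappC K _ => K.Wf
  | .pairL K _ _ => K.Wf
  | .pairR f K _ => IsResult f ∧ K.Wf
  | .retC _ K => K.Wf
  | .proj1C K => K.Wf
  | .proj2C K => K.Wf
  | .injlC _ K => K.Wf
  | .injrC _ K => K.Wf
  | .bindC _ K _ => K.Wf
  | .caseC K _ _ _ _ => K.Wf
  | .retToC K _ => K.Wf
  | .selectL K _ _ => K.Wf
  | .selectR f K _ => IsResult f ∧ K.Wf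
  | .compareL _ K _ => K.Wf
  | .compareR _ f K => IsResult f ∧ K.Wf

/-! ## Local semantics -/

/-- Local redex rules (without the compare-failure rule and without
    bracketed rules). -/
inductive LocalBase : Expr → Expr → Prop where
  | app {x τ pc e v} : IsValue v →
      LocalBase (.app (.lam x τ pc e) v) (subst e x v)
  | tapp {X pc e τ} : LocalBase (.tapp (.tlam X pc e) τ) (substTE e X τ)
  | unpair1 {v1 v2 τ} : IsValue v1 → IsValue v2 →
      LocalBase (.proj1 (.pair v1 v2 τ)) v1
  | unpair2 {v1 v2 τ} : IsValue v1 → IsValue v2 →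
      LocalBase (.proj2 (.pair v1 v2 τ)) v2
  | sealedStep {l v} : IsValue v → LocalBase (.ret l v) (.sealed l v)
  | bindM {x l v e} : IsValue v →
      LocalBase (.bind x (.sealed l v) e) (subst e x v)
  | caseL {τs v x e1 e2} : IsValue v →
      LocalBase (.caseE (.injl τs v) x e1 e2 τs) (subst e1 x v)
  | caseR {τs v x e1 e2} : IsValue v →
      LocalBase (.caseE (.injr τs v) x e1 e2 τs) (subst e2 x v)
  | compareEq {l1 l2 τ v} : IsValue v →
      LocalBase (.compare (.says (cmpAct l1 l2) τ) (.sealed l1 v) (.sealed l2 v))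
        (.sealed (cmpAct l1 l2) v)
  | compareFailL {l1 l2 τ f2} : IsResult f2 →
      LocalBase (.compare (.says (cmpAct l1 l2) τ) (.fail (.says l1 τ)) f2)
        (.fail (.says (cmpAct l1 l2) τ))
  | compareFailR {l1 l2 τ f1} : IsResult f1 →
      LocalBase (.compare (.says (cmpAct l1 l2) τ) f1 (.fail (.says l2 τ)))
        (.fail (.says (cmpAct l1 l2) τ))
  | selectL {l1 l2 τ v1 f2} : IsValue v1 →
      (f2 = .fail (.says l2 τ) ∨ ∃ v2, IsValue v2 ∧ f2 = .sealed l2 v2) →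
      LocalBase (.select (.sealed l1 v1) f2 (.says (selAct l1 l2) τ))
        (.sealed (selAct l1 l2) v1)
  | selectR {l1 l2 τ v2 f1} : IsValue v2 →
      (f1 = .fail (.says l1 τ) ∨ ∃ v1, IsValue v1 ∧ f1 = .sealed l1 v1) →
      LocalBase (.select f1 (.sealed l2 v2) (.says (selAct l1 l2) τ))
        (.sealed (selAct l1 l2) v2)
  | selectFail {l1 l2 τ} :
      LocalBase (.select (.fail (.says l1 τ)) (.fail (.says l2 τ))
          (.says (selAct l1 l2) τ))
        (.fail (.says (selAct l1 l2) τ))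
  -- failure propagation
  | appFailL {x τ pc τ' e} :
      LocalBase (.app (.lam x τ pc (.fail (.fn τ pc τ'))) e) (.fail τ')
  | appFail {x τ pc e} :
      LocalBase (.app (.lam x τ pc e) (.fail τ)) (subst e x (.fail τ))
  | tappFail {X : String} {pc : Prin} {τ τ' : Ty} :
      LocalBase (.tapp (.fail (.poly X pc τ)) τ') (.fail (τ.substT X τ'))
  | sealedFail {l τ} : LocalBase (.ret l (.fail τ)) (.fail (.says l τ))
  | injlFail {τ1 τ2} :
      LocalBase (.injl (.sum τ1 τ2) (.fail τ1)) (.fail (.sum τ1 τ2))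
  | injrFail {τ1 τ2} :
      LocalBase (.injr (.sum τ1 τ2) (.fail τ2)) (.fail (.sum τ1 τ2))
  | caseFail {τ' x e1 e2 τs τ} :
      LocalBase (.caseE (.fail τ') x e1 e2 τs) (.fail τ)
  | pairFailL {τ1 τ2 f2} : IsResult f2 →
      LocalBase (.pair (.fail τ1) f2 (.prod τ1 τ2)) (.fail (.prod τ1 τ2))
  | pairFailR {τ1 τ2 f1} : IsResult f1 →
      LocalBase (.pair f1 (.fail τ2) (.prod τ1 τ2)) (.fail (.prod τ1 τ2))
  | projFail1 {τ1 τ2} : LocalBase (.proj1 (.fail (.prod τ1 τ2))) (.fail τ1)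
  | projFail2 {τ1 τ2} : LocalBase (.proj2 (.fail (.prod τ1 τ2))) (.fail τ2)

/-- The (bracketed) local small-step semantics `e ⟶ e'`. -/
inductive Step : Expr → Expr → Prop where
  | base {e e'} : LocalBase e e' → Step e e'
  | compareFail {l1 l2 τ v1 v2} : IsValue v1 → IsValue v2 → v1 ≠ v2 →
      Step (.compare (.says (cmpAct l1 l2) τ) (.sealed l1 v1) (.sealed l2 v2))
        (.fail (.says (cmpAct l1 l2) τ))
  | ctx {K : ECtx} {e e'} : K.Wf → Step e e' → Step (K.fill e) (K.fill e')
  | bStepL {e1 e1' e2} : Step e1 e1' → Step (.bracket e1 e2) (.bracket e1' e2)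
  | bStepR {e1 e2 e2'} : Step e2 e2' → Step (.bracket e1 e2) (.bracket e1 e2')
  | bApp {v1 v2 v} : IsValue v1 → IsValue v2 → IsValue v →
      Step (.app (.bracket v1 v2) v)
        (.bracket (.app v1 (bproj true v)) (.app v2 (bproj false v)))
  | bTApp {v v' τ} : IsValue v → IsValue v' →
      Step (.tapp (.bracket v v') τ) (.bracket (.tapp v τ) (.tapp v' τ))
  | bBindM {x v v' e} : IsValue v → IsValue v' →
      Step (.bind x (.bracket v v') e)
        (.bracket (.bind x v (bproj true e)) (.bind x v' (bproj false e)))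
  | bCompareCommon {τ f11 f12 f21 f22 g1 g2} :
      IsResult f11 → IsResult f12 → IsResult f21 → IsResult f22 →
      Step (bproj true (.compare τ (.bracket f11 f12) (.bracket f21 f22))) g1 →
      Step (bproj false (.compare τ (.bracket f11 f12) (.bracket f21 f22))) g2 →
      Step (.compare τ (.bracket f11 f12) (.bracket f21 f22)) (.bracket g1 g2)
  | bCompareCommonRight {τ f11 f12 f g1 g2} :
      IsResult f11 → IsResult f12 → IsResult f →
      Step (bproj true (.compare τ (.bracket f11 f12) f)) g1 →
      Step (bproj false (.compare τ (.bracket f11 f12) f)) g2 →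
      Step (.compare τ (.bracket f11 f12) f) (.bracket g1 g2)
  | bCompareCommonLeft {τ f f21 f22 g1 g2} :
      IsResult f → IsResult f21 → IsResult f22 →
      Step (bproj true (.compare τ f (.bracket f21 f22))) g1 →
      Step (bproj false (.compare τ f (.bracket f21 f22))) g2 →
      Step (.compare τ f (.bracket f21 f22)) (.bracket g1 g2)
  | bSelectCommon {τ f11 f12 f21 f22 g1 g2} :
      IsResult f11 → IsResult f12 → IsResult f21 → IsResult f22 →
      Step (bproj true (.select (.bracket f11 f12) (.bracket f21 f22) τ)) g1 →
      Step (bproj false (.select (.bracket f11 f12) (.bracket f21 f22) τ)) g2 →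
      Step (.select (.bracket f11 f12) (.bracket f21 f22) τ) (.bracket g1 g2)
  | bSelectCommonLeft {τ f11 f12 f g1 g2} :
      IsResult f11 → IsResult f12 → IsResult f →
      Step (bproj true (.select (.bracket f11 f12) f τ)) g1 →
      Step (bproj false (.select (.bracket f11 f12) f τ)) g2 →
      Step (.select (.bracket f11 f12) f τ) (.bracket g1 g2)
  | bSelectCommonRight {τ f f21 f22 g1 g2} :
      IsResult f → IsResult f21 → IsResult f22 →
      Step (bproj true (.select f (.bracket f21 f22) τ)) g1 →
      Step (bproj false (.select f (.bracket f21 f22) τ)) g2 →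
      Step (.select f (.bracket f21 f22) τ) (.bracket g1 g2)
  | bFail1 {l v τ} : IsValue v →
      Step (.ret l (.bracket v (.fail τ)))
        (.bracket (.sealed l v) (.fail (.says l τ)))
  | bFail2 {l v τ} : IsValue v →
      Step (.ret l (.bracket (.fail τ) v))
        (.bracket (.fail (.says l τ)) (.sealed l v))
  | bFail {l τ} :
      Step (.ret l (.bracket (.fail τ) (.fail τ))) (.fail (.says l τ))

/-- `e` is stuck: it is neither a value nor a fail term, and no local step
    applies. -/
def Stuck (e : Expr) : Prop := ¬ IsResult e ∧ ∀ e', ¬ Step e e'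

abbrev Steps : Expr → Expr → Prop := Relation.ReflTransGen Step

/-! ## Global configurations and semantics -/

inductive Stack where
  | nil : Stack
  | cons : Expr → Prin → Stack → Stack

structure Config where
  e : Expr
  host : Prin
  stk : Stack

def bprojStack (k : Bool) : Stack → Stack
  | .nil => .nil
  | .cons e c t => .cons (bproj k e) c (bprojStack k t)

def bprojConfig (k : Bool) (s : Config) : Config :=
  ⟨bproj k s.e, s.host, bprojStack k s.stk⟩

/-- Turn a returned result into a sealed value or a propagated failure. -/
def sealOrFail (l : Prin) (τ : Ty) : Expr → Expr
  | .fail _ => .fail (.says l τ)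
  | v => .sealed l v

/-- The (bracketed) global small-step semantics `⟨e,c,t⟩ ⟹ ⟨e',c',t'⟩`. -/
inductive GStep : Config → Config → Prop where
  | lift {e e' c t} : Step e e' → GStep ⟨e, c, t⟩ ⟨e', c, t⟩
  | run {K : ECtx} {τ e c c' t} : K.Wf →
      GStep ⟨K.fill (.run τ e c'), c, t⟩
            ⟨.retTo e c, c', .cons (K.fill (.expect τ)) c t⟩
  | retV {K : ECtx} {v c c' l τ' t} : K.Wf → IsValue v →
      GStep ⟨.retTo v c, c', .cons (K.fill (.expect (.says l τ'))) c t⟩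
            ⟨K.fill (.sealed l v), c, t⟩
  | retFail {K : ECtx} {c c' l τ' t} : K.Wf →
      GStep ⟨.retTo (.fail τ') c, c', .cons (K.fill (.expect (.says l τ'))) c t⟩
            ⟨K.fill (.fail (.says l τ')), c, t⟩
  | bRunLeft {K : ECtx} {τ e e2 c c' t} : K.Wf →
      GStep ⟨.bracket (K.fill (.run τ e c')) e2, c, t⟩
            ⟨.bracket (.retTo e c) .hole, c',
              .cons (.bracket (K.fill (.expect τ)) e2) c t⟩
  | bRunRight {K : ECtx} {τ e e1 c c' t} : K.Wf →
      GStep ⟨.bracket e1 (K.fill (.run τ e c')), c, t⟩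
            ⟨.bracket .hole (.retTo e c), c',
              .cons (.bracket e1 (K.fill (.expect τ))) c t⟩
  | bRetLeft {K : ECtx} {f e2 c c' l τ t} : K.Wf → IsResult f →
      GStep ⟨.bracket (.retTo f c) .hole, c',
              .cons (.bracket (K.fill (.expect (.says l τ))) e2) c t⟩
            ⟨.bracket (K.fill (sealOrFail l τ f)) e2, c, t⟩
  | bRetRight {K : ECtx} {f e2 c c' l τ t} : K.Wf → IsResult f →
      GStep ⟨.bracket .hole (.retTo f c), c',
              .cons (.bracket e2 (K.fill (.expect (.says l τ)))) c t⟩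
            ⟨.bracket e2 (K.fill (sealOrFail l τ f)), c, t⟩
  | bRetV {K : ECtx} {f1 f2 c c' l τ t} : K.Wf → IsResult f1 → IsResult f2 →
      GStep ⟨.retTo (.bracket f1 f2) c, c',
              .cons (K.fill (.expect (.says l τ))) c t⟩
            ⟨K.fill (.bracket (sealOrFail l τ f1) (sealOrFail l τ f2)), c, t⟩

abbrev GSteps : Config → Config → Prop := Relation.ReflTransGen GStep

/-! ## Typing -/

inductive TBind where
  | tv : String → TBind
  | ev : String → Ty → TBind
  deriving DecidableEq

abbrev TCtx := List TBind

def lookupVar : TCtx → String → Option Ty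
  | [], _ => none
  | .ev y τ :: Γ, x => if y = x then some τ else lookupVar Γ x
  | .tv _ :: Γ, x => lookupVar Γ x

/-- Type-protection judgment `Π ⊢ ℓ ⊑ τ`. -/
inductive Prot (Pi : DCtx) : Prin → Ty → Prop where
  | unit {l} : Prot Pi l .unit
  | pair {l τ1 τ2} : Prot Pi l τ1 → Prot Pi l τ2 → Prot Pi l (.prod τ1 τ2)
  | fn {l τ1 pc' τ2} : Prot Pi l τ2 → FlowsTo Pi l pc' → Prot Pi l (.fn τ1 pc' τ2)
  | poly {l X pc' τ} : Prot Pi l τ → FlowsTo Pi l pc' → Prot Pi l (.poly X pc' τ)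
  | lbl {l l' τ} : FlowsTo Pi l l' → Prot Pi l (.says l' τ)

/-- Reads judgment `Π ⊩ p ▷ τ`. -/
inductive Reads (Pi : DCtx) : Prin → Ty → Prop where
  | unit {p} : Reads Pi p .unit
  | sum {p τ1 τ2} : Reads Pi p τ1 → Reads Pi p τ2 → Reads Pi p (.sum τ1 τ2)
  | prod {p τ1 τ2} : Reads Pi p τ1 → Reads Pi p τ2 → Reads Pi p (.prod τ1 τ2)
  | lbl {p l : Prin} {τ : Ty} : ActsFor Pi (p.proj .c) (l.proj .c) → Reads Pi p τ →
      Reads Pi p (.says l τ)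
  | fn {p τ1 pc τ2} : Reads Pi p τ1 → Reads Pi p τ2 → Reads Pi p (.fn τ1 pc τ2)
  | poly {p X pc τ} : Reads Pi p τ → Reads Pi p (.poly X pc τ)

/-- The fails judgment `Π ⊩ ℓ ⋗ τ`. -/
inductive Fails (Pi : DCtx) : Prin → Ty → Prop where
  | pairL {l : Prin} {τ1 τ2 : Ty} : Fails Pi l τ1 → Fails Pi l (.prod τ1 τ2)
  | pairR {l : Prin} {τ1 τ2 : Ty} : Fails Pi l τ2 → Fails Pi l (.prod τ1 τ2)
  | sumL {l : Prin} {τ1 τ2 : Ty} : Fails Pi l τ1 → Fails Pi l (.sum τ1 τ2)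
  | sumR {l : Prin} {τ1 τ2 : Ty} : Fails Pi l τ2 → Fails Pi l (.sum τ1 τ2)
  | fn {l pc' : Prin} {τ1 τ2 : Ty} : Fails Pi l τ2 → Fails Pi l (.fn τ1 pc' τ2)
  | type {l l' : Prin} {τ : Ty} : Fails Pi l τ → Fails Pi l (.says l' τ)
  | avail {l l' : Prin} {τ : Ty} : ActsFor Pi (l.proj .a) (l'.proj .a) → Fails Pi l (.says l' τ)
  | integComL {l l1 l2 : Prin} {τ : Ty} : ActsFor Pi (l.proj .i) (l1.proj .i) →
      Fails Pi l (.says (cmpAct l1 l2) τ)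
  | integComR {l l1 l2 : Prin} {τ : Ty} : ActsFor Pi (l.proj .i) (l2.proj .i) →
      Fails Pi l (.says (cmpAct l1 l2) τ)

/-- The FLAQR typing judgment `Π;Γ;pc;c ⊢ e : τ`, including the bracket
    typing rules parameterized by an attacker `H` and a projection `π`. -/
inductive HasTy (Pi : DCtx) (H : Prin) (π : Proj) :
    TCtx → Prin → Prin → Expr → Ty → Prop where
  | var {Γ pc c x τ} : lookupVar Γ x = some τ → ActsFor Pi c pc →
      HasTy Pi H π Γ pc c (.var x) τ
  | unit {Γ pc c} : ActsFor Pi c pc → HasTy Pi H π Γ pc c .unit .unit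
  | fail {Γ pc c τ} : ActsFor Pi c pc → HasTy Pi H π Γ pc c (.fail τ) τ
  | expect {Γ pc c τ} : ActsFor Pi c pc → HasTy Pi H π Γ pc c (.expect τ) τ
  | lam {Γ pc c x τ1 pc' e τ2} :
      HasTy Pi H π (.ev x τ1 :: Γ) pc' (clearance (.fn τ1 pc' τ2)) e τ2 →
      ActsFor Pi c pc → ActsFor Pi c (clearance (.fn τ1 pc' τ2)) →
      HasTy Pi H π Γ pc c (.lam x τ1 pc' e) (.fn τ1 pc' τ2)
  | app {Γ pc c e1 e2 τ' pc' τ} :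
      HasTy Pi H π Γ pc c e1 (.fn τ' pc' τ) → HasTy Pi H π Γ pc c e2 τ' →
      FlowsTo Pi pc pc' → ActsFor Pi c pc →
      HasTy Pi H π Γ pc c (.app e1 e2) τ
  | tlam {Γ pc c X pc' e τ} :
      HasTy Pi H π (.tv X :: Γ) pc' (clearance τ) e τ →
      ActsFor Pi c pc → ActsFor Pi c (clearance τ) →
      HasTy Pi H π Γ pc c (.tlam X pc' e) (.poly X pc' τ)
  | tapp {Γ : TCtx} {pc c : Prin} {e : Expr} {X : String} {pc' : Prin} {τ τ' : Ty} :
      HasTy Pi H π Γ pc c e (.poly X pc' τ) →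
      FlowsTo Pi pc pc' → ActsFor Pi c pc →
      HasTy Pi H π Γ pc c (.tapp e τ') (τ.substT X τ')
  | pair {Γ pc c e1 e2 τ1 τ2} :
      HasTy Pi H π Γ pc c e1 τ1 → HasTy Pi H π Γ pc c e2 τ2 →
      ActsFor Pi c pc →
      HasTy Pi H π Γ pc c (.pair e1 e2 (.prod τ1 τ2)) (.prod τ1 τ2)
  | unpair1 {Γ pc c e τ1 τ2} : HasTy Pi H π Γ pc c e (.prod τ1 τ2) →
      ActsFor Pi c pc → HasTy Pi H π Γ pc c (.proj1 e) τ1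
  | unpair2 {Γ pc c e τ1 τ2} : HasTy Pi H π Γ pc c e (.prod τ1 τ2) →
      ActsFor Pi c pc → HasTy Pi H π Γ pc c (.proj2 e) τ2
  | injl {Γ pc c e τ1 τ2} : HasTy Pi H π Γ pc c e τ1 → ActsFor Pi c pc →
      HasTy Pi H π Γ pc c (.injl (.sum τ1 τ2) e) (.sum τ1 τ2)
  | injr {Γ pc c e τ1 τ2} : HasTy Pi H π Γ pc c e τ2 → ActsFor Pi c pc →
      HasTy Pi H π Γ pc c (.injr (.sum τ1 τ2) e) (.sum τ1 τ2)
  | caseE {Γ pc c e x e1 e2 τ1 τ2 τ} :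
      HasTy Pi H π Γ pc c e (.sum τ1 τ2) → Prot Pi pc τ →
      ActsFor Pi (tyAvail τ1) (tyAvail τ) → ActsFor Pi (tyAvail τ2) (tyAvail τ) →
      HasTy Pi H π (.ev x τ1 :: Γ) pc c e1 τ →
      HasTy Pi H π (.ev x τ2 :: Γ) pc c e2 τ →
      ActsFor Pi c pc →
      HasTy Pi H π Γ pc c (.caseE e x e1 e2 (.sum τ1 τ2)) τ
  | unitM {Γ pc c e τ l} : HasTy Pi H π Γ pc c e τ → FlowsTo Pi pc l →
      ActsFor Pi c pc → HasTy Pi H π Γ pc c (.ret l e) (.says l τ)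
  | sealedT {Γ pc c v τ l} : HasTy Pi H π Γ pc c v τ → IsValue v →
      ActsFor Pi c pc → HasTy Pi H π Γ pc c (.sealed l v) (.says l τ)
  | bindM {Γ pc c x e' e l τ' τ} :
      HasTy Pi H π Γ pc c e' (.says l τ') → Prot Pi (pJoin l pc) τ →
      HasTy Pi H π (.ev x τ' :: Γ) (pJoin l pc) c e τ → ActsFor Pi c pc →
      HasTy Pi H π Γ pc c (.bind x e' e) τ
  | runT {Γ pc c e pc' c' τ'} :
      HasTy Pi H π Γ pc' c' e τ' → FlowsTo Pi pc pc' → ActsFor Pi c pc →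
      ActsFor Pi c (clearance τ') →
      HasTy Pi H π Γ pc c (.run (.says (reach pc') τ') e c')
        (.says (reach pc') τ')
  | retT {Γ pc c e c' τ} :
      HasTy Pi H π Γ pc c e τ → ActsFor Pi c' (clearance τ) → ActsFor Pi c pc →
      HasTy Pi H π Γ pc c (.retTo e c') (.says (reach pc) τ)
  | compareT {Γ pc c e1 e2 l1 l2 τ} :
      HasTy Pi H π Γ pc c e1 (.says l1 τ) → HasTy Pi H π Γ pc c e2 (.says l2 τ) →
      Reads Pi c (.says l1 τ) → Reads Pi c (.says l2 τ) → ActsFor Pi c pc →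
      HasTy Pi H π Γ pc c (.compare (.says (cmpAct l1 l2) τ) e1 e2)
        (.says (cmpAct l1 l2) τ)
  | selectT {Γ pc c e1 e2 l1 l2 τ} :
      HasTy Pi H π Γ pc c e1 (.says l1 τ) → HasTy Pi H π Γ pc c e2 (.says l2 τ) →
      ActsFor Pi c pc →
      HasTy Pi H π Γ pc c (.select e1 e2 (.says (selAct l1 l2) τ))
        (.says (selAct l1 l2) τ)
  -- bracket typing rules
  | bracket {Γ pc pc' c e1 e2 τ} :
      FlowsTo Pi (pJoin (H.proj π) pc) pc' →
      (IsValue e1 ↔ ¬ IsValue e2) →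
      HasTy Pi H π Γ pc' c e1 τ → HasTy Pi H π Γ pc' c e2 τ →
      Prot Pi (H.proj π) (cfunTy τ) → ActsFor Pi c pc →
      HasTy Pi H π Γ pc c (.bracket e1 e2) τ
  | bracketValues {Γ pc c v1 v2 τ} :
      IsValue v1 → IsValue v2 →
      HasTy Pi H π Γ pc c v1 τ → HasTy Pi H π Γ pc c v2 τ →
      Prot Pi (H.proj π) (cfunTy τ) → ActsFor Pi c pc →
      HasTy Pi H π Γ pc c (.bracket v1 v2) τ
  | bullR {Γ pc c e τ} : HasTy Pi H π Γ pc c e τ →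
      HasTy Pi H π Γ pc c (.bracket e .hole) τ
  | bullL {Γ pc c e τ} : HasTy Pi H π Γ pc c e τ →
      HasTy Pi H π Γ pc c (.bracket .hole e) τ
  | bracketFailL {Γ pc c e τ} : HasTy Pi H π Γ pc c e τ →
      HasTy Pi H π Γ pc c (.bracket e (.fail τ)) τ
  | bracketFailR {Γ pc c e τ} : HasTy Pi H π Γ pc c e τ →
      HasTy Pi H π Γ pc c (.bracket (.fail τ) e) τ
  | bracketFailA {Γ pc c e1 e2 τ} :
      HasTy Pi H π Γ pc c e1 τ → HasTy Pi H π Γ pc c e2 τ →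
      e1 ≠ .fail τ → e2 ≠ .fail τ → π = .a →
      HasTy Pi H π Γ pc c (.bracket e1 e2) τ
  | bracketSame {Γ pc c v τ} : IsValue v → HasTy Pi H π Γ pc c v τ →
      HasTy Pi H π Γ pc c (.bracket v v) τ

/-- Stack typing `Π;Γ;pc ⊢ t : [τ']τ`. -/
inductive StackTy (Pi : DCtx) (H : Prin) (π : Proj) (Γ : TCtx) (pc : Prin) :
    Stack → Ty → Ty → Prop where
  | emp {τ} : StackTy Pi H π Γ pc .nil τ τ
  | tail {K : ECtx} {pc' c τ' τh t τ} : K.Wf →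
      HasTy Pi H π Γ pc' c (K.fill (.expect τ')) τh →
      StackTy Pi H π Γ pc t τh τ → FlowsTo Pi pc pc' → ActsFor Pi c pc →
      StackTy Pi H π Γ pc (.cons (K.fill (.expect τ')) c t) τ' τ
  | tailBracketL {K : ECtx} {pc' c τ' τh e2 t τ} : K.Wf →
      HasTy Pi H π Γ pc' c (.bracket (K.fill (.expect τ')) e2) τh →
      StackTy Pi H π Γ pc t τh τ → FlowsTo Pi pc pc' → ActsFor Pi c pc →
      StackTy Pi H π Γ pc (.cons (.bracket (K.fill (.expect τ')) e2) c t) τ' τ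
  | tailBracketR {K : ECtx} {pc' c τ' τh e2 t τ} : K.Wf →
      HasTy Pi H π Γ pc' c (.bracket e2 (K.fill (.expect τ'))) τh →
      StackTy Pi H π Γ pc t τh τ → FlowsTo Pi pc pc' → ActsFor Pi c pc →
      StackTy Pi H π Γ pc (.cons (.bracket e2 (K.fill (.expect τ'))) c t) τ' τ

/-- Global configuration typing `Π;Γ;pc ⊢ ⟨e,c,t⟩ : τ`. -/
inductive ConfigTy (Pi : DCtx) (H : Prin) (π : Proj) (Γ : TCtx) (pc : Prin) :
    Config → Ty → Prop where
  | head {pc' c e τ' t τ} :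
      HasTy Pi H π Γ pc' c e τ' → StackTy Pi H π Γ pc t τ' τ →
      FlowsTo Pi pc pc' → ActsFor Pi c pc →
      ConfigTy Pi H π Γ pc ⟨e, c, t⟩ τ

/-! ## Blame constraints and the blame semantics -/

inductive Blame where
  | empty : Blame                    -- F = ∅
  | atom : Prin → Blame              -- ℓ ∈ F
  | or : Blame → Blame → Blame
  | and : Blame → Blame → Blame
  deriving DecidableEq

/-- Blame-constraint entailment `𝒞 ⊩ ℓ ∈ F` (rules C-In, C-Or, C-AndL). -/
inductive Entails (Pi : DCtx) : Blame → Prin → Prop where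
  | inAtom {l' l} : ActsFor Pi l' l → Entails Pi (.atom l') l
  | orE {C1 C2 l} : Entails Pi C1 l → Entails Pi C2 l → Entails Pi (.or C1 C2) l
  | andL {C1 C2 l} : Entails Pi C1 l → Entails Pi (.and C1 C2) l
  | andR {C1 C2 l} : Entails Pi C2 l → Entails Pi (.and C1 C2) l

/-- The possible faulty sets implied by a blame constraint (one minimal set
    per DNF disjunct). -/
def Blame.faultySets : Blame → Set (Finset Prin)
  | .empty => {(∅ : Finset Prin)}
  | .atom l => {({l} : Finset Prin)}
  | .or C1 C2 => C1.faultySets ∪ C2.faultySets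
  | .and C1 C2 => {F | ∃ F1 ∈ C1.faultySets, ∃ F2 ∈ C2.faultySets, F = F1 ∪ F2}

/-- Conjoin an atom `ℓ ∈ F` onto a constraint, keeping DNF. -/
def Blame.andAtom (l : Prin) : Blame → Blame
  | .empty => .atom l
  | .atom l' => .and (.atom l') (.atom l)
  | .or C1 C2 => .or (C1.andAtom l) (C2.andAtom l)
  | .and C1 C2 => .and (.and C1 C2) (.atom l)

open Classical in
/-- Fallback case of the blame-update function `Λ`. -/
noncomputable def blameFallback (Pi : DCtx) (f1 f2 : Expr) (C : Blame)
    (l1 l2 : Prin) : Blame :=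
  if f1 = f2 then C
  else if Entails Pi C l1 ∨ Entails Pi C l2 then C
  else .or (C.andAtom l1) (C.andAtom l2)

open Classical in
/-- The blame-update function `Λ(v1, v2, 𝒞, ℓ1, ℓ2)`. -/
noncomputable def blameLast (Pi : DCtx) :
    Expr → Expr → Blame → Prin → Prin → Blame
  | .sealed l v1, .sealed l' v2, C, l1, l2 =>
      if l = l' then
        if Entails Pi C l1 ∨ Entails Pi C l2 ∨ Entails Pi C l then C
        else blameLast Pi v1 v2 C l l
      else blameFallback Pi (.sealed l v1) (.sealed l' v2) C l1 l2
  | .ret l e1, .ret l' e2, C, l1, l2 =>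
      if l = l' then blameLast Pi e1 e2 C l1 l2
      else blameFallback Pi (.ret l e1) (.ret l' e2) C l1 l2
  | .injl τ e1, .injl τ' e2, C, l1, l2 =>
      if τ = τ' then blameLast Pi e1 e2 C l1 l2
      else blameFallback Pi (.injl τ e1) (.injl τ' e2) C l1 l2
  | .injr τ e1, .injr τ' e2, C, l1, l2 =>
      if τ = τ' then blameLast Pi e1 e2 C l1 l2
      else blameFallback Pi (.injr τ e1) (.injr τ' e2) C l1 l2
  | .pair e11 e12 τ, .pair e21 e22 τ', C, l1, l2 =>
      if τ = τ' then blameLast Pi e11 e21 (blameLast Pi e12 e22 C l1 l2) l1 l2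
      else blameFallback Pi (.pair e11 e12 τ) (.pair e21 e22 τ') C l1 l2
  | .run τ e1 p, .run τ' e2 p', C, l1, l2 =>
      if τ = τ' ∧ p = p' then blameLast Pi e1 e2 C l1 l2
      else blameFallback Pi (.run τ e1 p) (.run τ' e2 p') C l1 l2
  | .select e1 e2 τ, .select e1' e2' τ', C, l1, l2 =>
      if τ = τ' then blameLast Pi e1 e1' (blameLast Pi e2 e2' C l1 l2) l1 l2
      else blameFallback Pi (.select e1 e2 τ) (.select e1' e2' τ') C l1 l2
  | .compare τ e1 e2, .compare τ' e1' e2', C, l1, l2 =>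
      if τ = τ' then blameLast Pi e1 e1' (blameLast Pi e2 e2' C l1 l2) l1 l2
      else blameFallback Pi (.compare τ e1 e2) (.compare τ' e1' e2') C l1 l2
  | .lam x τ pc e1, .lam x' τ' pc' e2, C, l1, l2 =>
      if x = x' ∧ τ = τ' ∧ pc = pc' then blameLast Pi e1 e2 C l1 l2
      else blameFallback Pi (.lam x τ pc e1) (.lam x' τ' pc' e2) C l1 l2
  | .tlam X pc e1, .tlam X' pc' e2, C, l1, l2 =>
      if X = X' ∧ pc = pc' then blameLast Pi e1 e2 C l1 l2
      else blameFallback Pi (.tlam X pc e1) (.tlam X' pc' e2) C l1 l2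
  | .proj1 e1, .proj1 e2, C, l1, l2 => blameLast Pi e1 e2 C l1 l2
  | .proj2 e1, .proj2 e2, C, l1, l2 => blameLast Pi e1 e2 C l1 l2
  | .bind x e1 e1', .bind x' e2 e2', C, l1, l2 =>
      if x = x' then blameLast Pi e1 e2 (blameLast Pi e1' e2' C l1 l2) l1 l2
      else blameFallback Pi (.bind x e1 e1') (.bind x' e2 e2') C l1 l2
  | .caseE e1 z e2 e3 τ, .caseE e1' z' e2' e3' τ', C, l1, l2 =>
      if z = z' ∧ τ = τ' then
        blameLast Pi e1 e1'
          (blameLast Pi e2 e2' (blameLast Pi e3 e3' C l1 l2) l1 l2) l1 l2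
      else blameFallback Pi (.caseE e1 z e2 e3 τ) (.caseE e1' z' e2' e3' τ') C l1 l2
  | f1, f2, C, l1, l2 => blameFallback Pi f1 f2 C l1 l2
termination_by x _ _ _ _ => sizeOf x

/-- The local blame semantics: as the local semantics, but rule
    C-CompareFail updates the blame constraint via `Λ`. -/
inductive StepB (Pi : DCtx) : Expr → Blame → Expr → Blame → Prop where
  | base {e e' C} : LocalBase e e' → StepB Pi e C e' C
  | compareFail {l1 l2 τ v1 v2 C} : IsValue v1 → IsValue v2 → v1 ≠ v2 →
      StepB Pi (.compare (.says (cmpAct l1 l2) τ) (.sealed l1 v1) (.sealed l2 v2)) C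
        (.fail (.says (cmpAct l1 l2) τ)) (blameLast Pi v1 v2 C l1 l2)
  | ctx {K : ECtx} {e e' C C'} : K.Wf → StepB Pi e C e' C' →
      StepB Pi (K.fill e) C (K.fill e') C'

/-- The global blame semantics. -/
inductive GBStep (Pi : DCtx) : Config → Blame → Config → Blame → Prop where
  | lift {e e' c t C C'} : StepB Pi e C e' C' →
      GBStep Pi ⟨e, c, t⟩ C ⟨e', c, t⟩ C'
  | run {K : ECtx} {τ e c c' t C} : K.Wf →
      GBStep Pi ⟨K.fill (.run τ e c'), c, t⟩ C
               ⟨.retTo e c, c', .cons (K.fill (.expect τ)) c t⟩ C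
  | retV {K : ECtx} {v c c' l τ' t C} : K.Wf → IsValue v →
      GBStep Pi ⟨.retTo v c, c', .cons (K.fill (.expect (.says l τ'))) c t⟩ C
               ⟨K.fill (.sealed l v), c, t⟩ C
  | retFail {K : ECtx} {c c' l τ' t C} : K.Wf →
      GBStep Pi ⟨.retTo (.fail τ') c, c',
                  .cons (K.fill (.expect (.says l τ'))) c t⟩ C
               ⟨K.fill (.fail (.says l τ')), c, t⟩ C

/-- Multi-step blame semantics. -/
def GBSteps (Pi : DCtx) : Config × Blame → Config × Blame → Prop :=
  Relation.ReflTransGen (fun a b => GBStep Pi a.1 a.2 b.1 b.2)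

/-! ## Quorum systems -/

/-- Conjunction of a list of principals (`⊥` for the empty list). -/
def prinConjList : List Prin → Prin
  | [] => .bot
  | p :: ps => .conj p (prinConjList ps)

/-- `⋀_{p ∈ F} p`. -/
noncomputable def prinConj (F : Finset Prin) : Prin := prinConjList F.toList

abbrev QSys := Set (Finset Prin)

def hosts (Q : QSys) : Set Prin := {p | ∃ q ∈ Q, p ∈ q}

/-- Some quorum survives the failure of all hosts in `F`. -/
def Survives (Q : QSys) (F : Finset Prin) : Prop := ∃ q ∈ Q, ∀ p ∈ q, p ∉ F

/-- Maximal sets of hosts whose simultaneous failure leaves a quorum intact. -/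
def MaxFaultySets (Q : QSys) : Set (Finset Prin) :=
  {F | (∀ p ∈ F, p ∈ hosts Q) ∧ Survives Q F ∧
    ∀ F' : Finset Prin, (∀ p ∈ F', p ∈ hosts Q) → F ⊂ F' → ¬ Survives Q F'}

/-- The toleration set `T(𝒬)`. -/
def tolSet (Q : QSys) : Set Prin :=
  {t | ∃ F ∈ MaxFaultySets Q, t = reach (prinConj F)}

/-- The attacker set `𝒜_{T(𝒬)}`. -/
def attackers (Pi : DCtx) (Q : QSys) : Set Prin :=
  {l | ∃ t ∈ tolSet Q, ActsFor Pi t l}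

/-- `𝒬` guards `τ` (rule Q-Guard). -/
def Guards (Pi : DCtx) (Q : QSys) (τ : Ty) : Prop :=
  ∀ l ∈ attackers Pi Q, ¬ Fails Pi l τ

/-- `C` is the initial blame constraint of the quorum system `Q`: its
    possible faulty sets are exactly the maximal tolerable faulty sets. -/
def IsInitBlame (Q : QSys) (C : Blame) : Prop :=
  C.faultySets = MaxFaultySets Q

/-! ## Observation function -/

open Classical in
/-- The observation function `O(e, Π, p, π)`. -/
noncomputable def observe (Pi : DCtx) (p : Prin) (π : Proj) : Expr → Expr
  | .fail _ => .circ
  | .var x => .var x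
  | .unit => .circ
  | .ret l e => .ret l (observe Pi p π e)
  | .sealed l v =>
      if FlowsTo Pi (l.proj π) (p.proj π) then .sealed l (observe Pi p π v)
      else .circ
  | .lam x τ pc e =>
      if FlowsTo Pi (pc.proj π) (p.proj π) then .lam x τ pc (observe Pi p π e)
      else .circ
  | .tlam X pc e =>
      if FlowsTo Pi (pc.proj π) (p.proj π) then .tlam X pc (observe Pi p π e)
      else .circ
  | .app e1 e2 => .app (observe Pi p π e1) (observe Pi p π e2)
  | .tapp e τ => .tapp (observe Pi p π e) τ
  | .pair e1 e2 τ =>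
      if observe Pi p π e1 = .circ ∨ observe Pi p π e2 = .circ then .circ
      else .pair (observe Pi p π e1) (observe Pi p π e2) τ
  | .proj1 e => .proj1 (observe Pi p π e)
  | .proj2 e => .proj2 (observe Pi p π e)
  | .injl τ e =>
      if observe Pi p π e = .circ then .circ else .injl τ (observe Pi p π e)
  | .injr τ e =>
      if observe Pi p π e = .circ then .circ else .injr τ (observe Pi p π e)
  | .caseE e x e1 e2 τ =>
      .caseE (observe Pi p π e) x (observe Pi p π e1) (observe Pi p π e2) τ
  | .bind x e1 e2 => .bind x (observe Pi p π e1) (observe Pi p π e2)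
  | .select e1 e2 τ => .select (observe Pi p π e1) (observe Pi p π e2) τ
  | .compare τ e1 e2 => .compare τ (observe Pi p π e1) (observe Pi p π e2)
  | .run _ e _ => observe Pi p π e
  | .retTo e _ => observe Pi p π e
  | .expect τ => .expect τ
  | .bracket e1 e2 => .bracket (observe Pi p π e1) (observe Pi p π e2)
  | .hole => .hole
  | .circ => .circ

/-! ## Context machinery for type substitution -/

def substCtx (Γ : TCtx) (X : String) (s : Ty) : TCtx :=
  Γ.map (fun b => match b with
    | .tv Y => .tv Y
    | .ev x τ => .ev x (τ.substT X s))

/-- `τ` is well-formed in `Γ`: all its free type variables are bound. -/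
def WfTy (Γ : TCtx) (τ : Ty) : Prop := ∀ X ∈ τ.ftv, TBind.tv X ∈ Γ

namespace ActsFor

variable {Pi : DCtx} {p q : Prin}

theorem bot_proj_of_proj_c {π : Proj} (hπ : .c ≠ π) (h : ActsFor Pi (p.proj .c) p) :
    ActsFor Pi .bot (p.proj π) :=
  .trans (.projBasis hπ) (.projMono π h)

theorem pJoin_proj_c_left : ActsFor Pi (pJoin p q) (p.proj .c) :=
  .conjL1 (.conjL1 (.conjL1 (.refl _)))

theorem pJoin_proj_c_right : ActsFor Pi (pJoin p q) (q.proj .c) :=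
  .conjL1 (.conjL1 (.conjL2 (.refl _)))

/-- A join with a purely confidential left component is purely confidential. -/
theorem pJoin_proj_c_of_left (h : ActsFor Pi (p.proj .c) p) :
    ActsFor Pi ((pJoin p q).proj .c) (pJoin p q) := by
  refine .conjR (.conjR (.conjR ?_ ?_) (.disjR1 ?_)) (.disjR1 ?_)
  · exact .trans (.projMono .c pJoin_proj_c_left) .projIdemp
  · exact .trans (.projMono .c pJoin_proj_c_right) .projIdemp
  · exact .trans (.bot _) (bot_proj_of_proj_c (by decide) h)
  · exact .trans (.bot _) (bot_proj_of_proj_c (by decide) h)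

/-- A join with a purely confidential right component is purely confidential. -/
theorem pJoin_proj_c_of_right (h : ActsFor Pi (q.proj .c) q) :
    ActsFor Pi ((pJoin p q).proj .c) (pJoin p q) := by
  refine .conjR (.conjR (.conjR ?_ ?_) (.disjR2 ?_)) (.disjR2 ?_)
  · exact .trans (.projMono .c pJoin_proj_c_left) .projIdemp
  · exact .trans (.projMono .c pJoin_proj_c_right) .projIdemp
  · exact .trans (.bot _) (bot_proj_of_proj_c (by decide) h)
  · exact .trans (.bot _) (bot_proj_of_proj_c (by decide) h)

end ActsFor

/-- Clearances carry confidentiality authority only: the integrity and availability of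
    `clearance τ` are trivial. -/
theorem clearance_proj_c (Pi : DCtx) (τ : Ty) :
    ActsFor Pi ((clearance τ).proj .c) (clearance τ) := by
  induction τ with
  | unit => exact .bot _
  | tvar => exact .bot _
  | sum _ _ ih _ => exact .pJoin_proj_c_of_left ih
  | prod _ _ ih _ => exact .pJoin_proj_c_of_left ih
  | fn _ _ _ ih _ => exact .pJoin_proj_c_of_left ih
  | poly _ _ _ ih => exact .pJoin_proj_c_of_right ih
  | _ => assumption

theorem ActsFor.clearance_left {Pi : DCtx} {p q : Prin} {τ : Ty}
    (h : ActsFor Pi p (pJoin (clearance τ) q)) : ActsFor Pi p (clearance τ) :=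
  .trans h (.trans pJoin_proj_c_left (clearance_proj_c Pi τ))

theorem ActsFor.clearance_right {Pi : DCtx} {p q : Prin} {τ : Ty}
    (h : ActsFor Pi p (pJoin q (clearance τ))) : ActsFor Pi p (clearance τ) :=
  .trans h (.trans pJoin_proj_c_right (clearance_proj_c Pi τ))

/-- **Values PC**: values can be retyped at any host/pc with sufficient
    authority. -/
theorem values_pc
    (Pi : DCtx) (H : Prin) (π : Proj) (Γ : TCtx) (pc pc' c c' : Prin)
    (v : Expr) (τ : Ty)
    (hv : IsValue v)
    (hty : HasTy Pi H π Γ pc c v τ)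
    (h1 : ActsFor Pi c' pc')
    (h2 : ActsFor Pi c' (clearance τ)) :
    HasTy Pi H π Γ pc' c' v τ := by
  induction hty with
  | unit => exact .unit h1
  | lam hbody _ _ => exact .lam hbody h1 h2
  | tlam hbody _ _ => exact .tlam hbody h1 h2.clearance_right
  | pair _ _ _ ih1 ih2 =>
    cases hv with
    | pair hv1 hv2 => exact .pair (ih1 hv1 h2.clearance_left) (ih2 hv2 h2.clearance_right) h1
  | injl _ _ ih =>
    cases hv with
    | injl hv => exact .injl (ih hv h2.clearance_left) h1
  | injr _ _ ih =>
    cases hv with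
    | injr hv => exact .injr (ih hv h2.clearance_right) h1
  | sealedT _ hv' _ ih => exact .sealedT (ih hv' h2) hv' h1
  | bracket _ hiff =>
    cases hv with
    | bracket hv1 hv2 => exact absurd hv2 (hiff.mp hv1)
  | bracketValues hv1 hv2 _ _ hprot _ ih1 ih2 =>
    exact .bracketValues hv1 hv2 (ih1 hv1 h2) (ih2 hv2 h2) hprot h1
  | bracketFailA _ _ hne1 hne2 hπ ih1 ih2 =>
    cases hv with
    | bracket hv1 hv2 => exact .bracketFailA (ih1 hv1 h2) (ih2 hv2 h2) hne1 hne2 hπ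
  | bracketSame hv' _ ih => exact .bracketSame hv' (ih hv' h2)
  | bullR | bracketFailL =>
    cases hv with
    | bracket _ hv2 => cases hv2
  | bullL | bracketFailR =>
    cases hv with
    | bracket hv1 _ => cases hv1
  | _ => cases hv

end FLAQR
end

section
/- Label Flowsto SelCmp: If Π ⊢ ℓ ⊑ ℓ1 and Π ⊢ ℓ ⊑ ℓ2, then Π ⊢ ℓ ⊑ ℓ1 ⊕ ℓ2 and Π ⊢ ℓ ⊑ ℓ1 ⊗ ℓ2. -/
set_option maxHeartbeats 1000000

namespace FLAQR

namespace ActsFor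

variable {Pi : DCtx} {p q r : Prin} {π π' : Proj}

theorem bot_left (h : ActsFor Pi .bot q) : ActsFor Pi p q :=
  (ActsFor.bot p).trans h

theorem por_right (hq : ActsFor Pi p q) (hr : ActsFor Pi p r) : ActsFor Pi p (.por q r) :=
  (ActsFor.pandR hq hr).trans .pandPOr

theorem proj_conj (hq : ActsFor Pi p (q.proj π)) (hr : ActsFor Pi p (r.proj π)) :
    ActsFor Pi p ((Prin.conj q r).proj π) :=
  (ActsFor.conjR hq hr).trans .projDistConj

theorem proj_pand (hq : ActsFor Pi p (q.proj π)) (hr : ActsFor Pi p (r.proj π)) :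
    ActsFor Pi p ((Prin.pand q r).proj π) :=
  (ActsFor.pandR hq hr).trans .projPAndL

theorem proj_por (hq : ActsFor Pi p (q.proj π)) (hr : ActsFor Pi p (r.proj π)) :
    ActsFor Pi p ((Prin.por q r).proj π) :=
  (por_right hq hr).trans .projPOrL

theorem proj_disj_left (hq : ActsFor Pi p (q.proj π)) :
    ActsFor Pi p ((Prin.disj q r).proj π) :=
  hq.trans (.projMono π (.disjR1 (.refl q)))

theorem proj_proj_of_ne (h : π ≠ π') : ActsFor Pi p ((q.proj π).proj π') :=
  bot_left (.projBasis h)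

theorem proj_proj_self (h : ActsFor Pi p (q.proj π)) : ActsFor Pi p ((q.proj π).proj π) :=
  h.trans .projR

theorem proj_of_acts_for_proj (h : ActsFor Pi p (q.proj π)) :
    ActsFor Pi (p.proj π) (q.proj π) :=
  (ActsFor.projMono π h).trans .projIdemp

end ActsFor

open ActsFor in
theorem FlowsTo.selAct {Pi : DCtx} {l l1 l2 : Prin} (h1 : FlowsTo Pi l l1)
    (h2 : FlowsTo Pi l l2) : FlowsTo Pi l (selAct l1 l2) := by
  obtain ⟨hc, hi1, ha1⟩ := h1
  obtain ⟨-, hi2, ha2⟩ := h2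
  refine ⟨?_, ?_, ?_⟩
  · exact (proj_of_acts_for_proj (.conjL1 (.conjL1 (.conjL1 (.refl _))))).trans hc
  · exact proj_conj
      (proj_conj (proj_conj (proj_proj_of_ne nofun) (proj_proj_of_ne nofun))
        (proj_por (proj_proj_self hi1) (proj_proj_self hi2)))
      (proj_conj (proj_proj_of_ne nofun) (proj_proj_of_ne nofun))
  · exact proj_conj
      (proj_conj (proj_conj (proj_proj_of_ne nofun) (proj_proj_of_ne nofun))
        (proj_por (proj_proj_of_ne nofun) (proj_proj_of_ne nofun)))
      (proj_conj (proj_proj_self ha1) (proj_proj_self ha2))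

open ActsFor in
theorem FlowsTo.cmpAct {Pi : DCtx} {l l1 l2 : Prin} (h1 : FlowsTo Pi l l1)
    (h2 : FlowsTo Pi l l2) : FlowsTo Pi l (cmpAct l1 l2) := by
  obtain ⟨hc, hi1, ha⟩ := h1
  obtain ⟨-, hi2, -⟩ := h2
  refine ⟨?_, ?_, ?_⟩
  · exact (proj_of_acts_for_proj (.conjL1 (.conjL1 (.conjL1 (.refl _))))).trans hc
  · exact proj_conj
      (proj_conj (proj_conj (proj_proj_of_ne nofun) (proj_proj_of_ne nofun))
        (proj_pand (proj_proj_self hi1) (proj_proj_self hi2)))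
      (proj_disj_left (proj_proj_of_ne nofun))
  · exact proj_conj
      (proj_conj (proj_conj (proj_proj_of_ne nofun) (proj_proj_of_ne nofun))
        (proj_pand (proj_proj_of_ne nofun) (proj_proj_of_ne nofun)))
      (proj_disj_left (proj_proj_self ha))

/-- **Label Flowsto SelCmp**. -/
theorem label_flowsto_selcmp
    (Pi : DCtx) (l l1 l2 : Prin)
    (h1 : FlowsTo Pi l l1) (h2 : FlowsTo Pi l l2) :
    FlowsTo Pi l (selAct l1 l2) ∧ FlowsTo Pi l (cmpAct l1 l2) :=
  ⟨h1.selAct h2, h1.cmpAct h2⟩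

end FLAQR
end
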